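/- arXiv:1410.3031 — 3 statements merged into one kernel-verified Lean document; each statement's English description precedes it below -/
import Mathlib

section
/- Let ρ_PQ be a density matrix on P×Q, σ_Q a density matrix on Q, n ≥ 1 a natural number, and k ∈ ℝ such that ρ_PQ ≤ 2^k·(ρ_P ⊗ σ_Q). Let τ_PQ := (1/n)·ρ_PQ + ((n−1)/n)·ρ_P ⊗ σ_Q. Then D(ρ_PQ ‖ τ_PQ) ≥ D(ρ_PQ ‖ ρ_P ⊗ σ_Q) − log(1 + 2^k/n). -/
open scoped Kronecker BigOperators
open Matrix
open scoped ComplexOrder Classical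

noncomputable section

/-- A density matrix: positive semidefinite with unit trace. -/
def IsDensityMatrix {d : Type*} [Fintype d] (ρ : Matrix d d ℂ) : Prop :=
  ρ.PosSemidef ∧ ρ.trace = 1

/-- Loewner order on Hermitian matrices: `A ≤ B` iff `B - A` is positive semidefinite. -/
def LoewnerLE {d : Type*} [Fintype d] (A B : Matrix d d ℂ) : Prop := (B - A).PosSemidef

/-- Partial trace over the second tensor factor. -/
def ptrace2 {d₁ d₂ : Type*} [Fintype d₂] (M : Matrix (d₁ × d₂) (d₁ × d₂) ℂ) :
    Matrix d₁ d₁ ℂ :=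
  fun i i' => ∑ k, M (i, k) (i', k)

/-- Partial trace over the first tensor factor. -/
def ptrace1 {d₁ d₂ : Type*} [Fintype d₁] (M : Matrix (d₁ × d₂) (d₁ × d₂) ℂ) :
    Matrix d₂ d₂ ℂ :=
  fun j j' => ∑ k, M (k, j) (k, j')

/-- Functional calculus for Hermitian matrices: apply `f` to the eigenvalues. -/
def hermCFC {d : Type*} [Fintype d] [DecidableEq d] (f : ℝ → ℝ) (A : Matrix d d ℂ) :
    Matrix d d ℂ :=
  if hA : A.IsHermitian then
    (hA.eigenvectorUnitary : Matrix d d ℂ) *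
      Matrix.diagonal (fun i => (f (hA.eigenvalues i) : ℂ)) *
      (star (hA.eigenvectorUnitary : Matrix d d ℂ))
  else 0

/-- Matrix logarithm, base 2, applied to nonzero eigenvalues. -/
def matLog2 {d : Type*} [Fintype d] [DecidableEq d] (A : Matrix d d ℂ) : Matrix d d ℂ :=
  hermCFC (Real.logb 2) A

/-- Positive semidefinite square root (via functional calculus). -/
def matSqrt {d : Type*} [Fintype d] [DecidableEq d] (A : Matrix d d ℂ) : Matrix d d ℂ :=
  hermCFC Real.sqrt A

/-- Support containment: the kernel of `σ` is contained in the kernel of `ρ`. -/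
def SupportLE {d : Type*} [Fintype d] (ρ σ : Matrix d d ℂ) : Prop :=
  ∀ v : d → ℂ, σ.mulVec v = 0 → ρ.mulVec v = 0

/-- Relative entropy, base 2, as a real number (meaningful when supports are nested). -/
def relentR {d : Type*} [Fintype d] [DecidableEq d] (ρ σ : Matrix d d ℂ) : ℝ :=
  ((ρ * matLog2 ρ).trace - (ρ * matLog2 σ).trace).re

/-- Relative entropy `D(ρ‖σ)`, base 2, valued in the extended reals: `+∞` unless
the support of `ρ` is contained in the support of `σ`. -/
def relent {d : Type*} [Fintype d] [DecidableEq d] (ρ σ : Matrix d d ℂ) : EReal :=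
  if SupportLE ρ σ then ((relentR ρ σ : ℝ) : EReal) else ⊤

/-- Mutual information `I(A:B)_ρ = D(ρ_AB ‖ ρ_A ⊗ ρ_B)`. -/
def mutInfo {d₁ d₂ : Type*} [Fintype d₁] [Fintype d₂] [DecidableEq d₁] [DecidableEq d₂]
    (ρ : Matrix (d₁ × d₂) (d₁ × d₂) ℂ) : EReal :=
  relent ρ (ptrace2 ρ ⊗ₖ ptrace1 ρ)

/-- Fidelity `F(ρ,σ) = Tr √(√σ ρ √σ)`. -/
def fidelity {d : Type*} [Fintype d] [DecidableEq d] (ρ σ : Matrix d d ℂ) : ℝ :=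
  ((matSqrt (matSqrt σ * ρ * matSqrt σ)).trace).re

/-- Purified distance `P(ρ,σ) = √(1 - F(ρ,σ)²)`. -/
def pdist {d : Type*} [Fintype d] [DecidableEq d] (ρ σ : Matrix d d ℂ) : ℝ :=
  Real.sqrt (1 - (fidelity ρ σ) ^ 2)

/-- Max-relative entropy `Dmax(ρ‖σ) = inf {λ : ρ ≤ 2^λ σ}`, valued in the extended reals. -/
def dmax {d : Type*} [Fintype d] (ρ σ : Matrix d d ℂ) : EReal :=
  sInf {x : EReal | ∃ l : ℝ, x = (l : EReal) ∧ LoewnerLE ρ (((2 : ℝ) ^ l) • σ)}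

/-- Max-information `Imax(A:B)_ρ`. -/
def imax {d₁ d₂ : Type*} [Fintype d₁] [Fintype d₂]
    (ρ : Matrix (d₁ × d₂) (d₁ × d₂) ℂ) : EReal :=
  ⨅ σ : {σ : Matrix d₂ d₂ ℂ // IsDensityMatrix σ}, dmax ρ (ptrace2 ρ ⊗ₖ σ.1)

/-- Smooth max-information `Imax^ε(A:B)_ρ`. -/
def imaxEps {d₁ d₂ : Type*} [Fintype d₁] [Fintype d₂] [DecidableEq d₁] [DecidableEq d₂]
    (ε : ℝ) (ρ : Matrix (d₁ × d₂) (d₁ × d₂) ℂ) : EReal :=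
  ⨅ ρ' : {ρ' : Matrix (d₁ × d₂) (d₁ × d₂) ℂ // IsDensityMatrix ρ' ∧ pdist ρ ρ' ≤ ε},
    imax ρ'.1

/-- The `j`-th term of the convex split: `ρ` on `P` and the `j`-th copy of `Q`, and
`σ` on every other copy of `Q`. -/
def blockState {P Q : Type*} [Fintype Q] [DecidableEq Q]
    (ρ : Matrix (P × Q) (P × Q) ℂ) (σ : Matrix Q Q ℂ) (n : ℕ) (j : Fin n) :
    Matrix (P × (Fin n → Q)) (P × (Fin n → Q)) ℂ :=
  fun x y => ρ (x.1, x.2 j) (y.1, y.2 j) * ∏ i ∈ Finset.univ.erase j, σ (x.2 i) (y.2 i)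

/-- The convex-split state `τ = (1/n) Σ_j ρ_{PQ_j} ⊗ σ_{Q_1} ⊗ ⋯ ⊗ σ_{Q_n}` (omitting `j`). -/
def convexSplit {P Q : Type*} [Fintype Q] [DecidableEq Q]
    (ρ : Matrix (P × Q) (P × Q) ℂ) (σ : Matrix Q Q ℂ) (n : ℕ) :
    Matrix (P × (Fin n → Q)) (P × (Fin n → Q)) ℂ :=
  ((n : ℂ)⁻¹) • ∑ j : Fin n, blockState ρ σ n j

/-- A finite nonempty index type. -/
structure FinIdx where
  carrier : Type
  [fin : Fintype carrier]
  [deq : DecidableEq carrier]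
  [ne : Nonempty carrier]

attribute [instance] FinIdx.fin FinIdx.deq FinIdx.ne

section LogarithmMonotonicity

open Filter Topology
open scoped MatrixOrder Matrix.Norms.L2Operator

variable {d : Type*} [Fintype d]

/-- The partial trace of a positive semidefinite matrix is positive semidefinite. -/
lemma Matrix.PosSemidef.ptrace2 {d₁ d₂ : Type*} [Fintype d₂]
    {M : Matrix (d₁ × d₂) (d₁ × d₂) ℂ} (hM : M.PosSemidef) : (ptrace2 M).PosSemidef := by
  have h : _root_.ptrace2 M = ∑ k, M.submatrix (fun i => (i, k)) (fun i => (i, k)) := by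
    ext i j
    simp [_root_.ptrace2, Matrix.sum_apply]
  rw [h]
  exact Matrix.posSemidef_sum _ fun k _ => hM.submatrix _

/-- A matrix dominated by a multiple of `B` has its support inside that of `B`. -/
lemma supportLE_of_le_smul {A B : Matrix d d ℂ} (hA : A.PosSemidef) {t : ℝ}
    (h : (t • B - A).PosSemidef) : SupportLE A B := by
  intro v hv
  have h1 := h.dotProduct_mulVec_nonneg v
  have h2 := hA.dotProduct_mulVec_nonneg v
  rw [Matrix.sub_mulVec, Matrix.smul_mulVec, hv, smul_zero, zero_sub, dotProduct_neg] at h1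
  exact (hA.dotProduct_mulVec_zero_iff v).mp (le_antisymm (neg_nonneg.mp h1) h2)

variable [DecidableEq d]

/-- Pairing with a positive semidefinite matrix is monotone for the Loewner order. -/
lemma Matrix.PosSemidef.re_trace_mul_le {ρ X Y : Matrix d d ℂ} (hρ : ρ.PosSemidef) (h : X ≤ Y) :
    (ρ * X).trace.re ≤ (ρ * Y).trace.re := by
  obtain ⟨B, rfl⟩ := CStarAlgebra.nonneg_iff_eq_star_mul_self.mp hρ.nonneg
  rw [Matrix.star_eq_conjTranspose]
  have h1 := ((Matrix.le_iff.mp h).mul_mul_conjTranspose_same B).trace_nonneg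
  rw [Matrix.trace_mul_comm, ← Matrix.mul_assoc, Matrix.mul_sub, Matrix.trace_sub] at h1
  have h2 := (Complex.le_def.mp h1).1
  simp only [Complex.zero_re, Complex.sub_re] at h2
  linarith

lemma hermCFC_eq_cfc (f : ℝ → ℝ) {A : Matrix d d ℂ} (hA : A.IsHermitian) :
    hermCFC f A = cfc f A := by
  rw [hermCFC, dif_pos hA, hA.cfc_eq, Matrix.IsHermitian.cfc, Unitary.conjStarAlgAut_apply]
  rfl

lemma trace_mul_hermCFC (f : ℝ → ℝ) (ρ : Matrix d d ℂ) {A : Matrix d d ℂ} (hA : A.IsHermitian) :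
    (ρ * hermCFC f A).trace =
      ∑ i, (f (hA.eigenvalues i) : ℂ) *
        (star (hA.eigenvectorUnitary : Matrix d d ℂ) * ρ * hA.eigenvectorUnitary) i i := by
  rw [hermCFC, dif_pos hA, ← Matrix.mul_assoc, Matrix.trace_mul_comm, ← Matrix.mul_assoc,
    ← Matrix.mul_assoc, Matrix.trace]
  simp [Matrix.mul_diagonal, mul_comm]

/-- If the support of `ρ` lies in that of `A`, the expectation of `log A` in `ρ` is the limit of
those of `log (A + ε)`. -/
lemma tendsto_re_trace_mul_matLog2 {ρ A : Matrix d d ℂ} (hA : A.IsHermitian)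
    (h : SupportLE ρ A) :
    Tendsto (fun ε : ℝ => (ρ * hermCFC (fun x => Real.logb 2 (x + ε)) A).trace.re)
      (𝓝[>] 0) (𝓝 (ρ * matLog2 A).trace.re) := by
  simp only [matLog2, trace_mul_hermCFC _ _ hA, Complex.re_sum, Complex.re_ofReal_mul]
  refine tendsto_finsetSum _ fun i _ => ?_
  by_cases hi : hA.eigenvalues i = 0
  · have hv : ρ *ᵥ (hA.eigenvectorBasis i).ofLp = 0 := by
      apply h
      rw [hA.mulVec_eigenvectorBasis, hi, zero_smul]
    have h0 : (star (hA.eigenvectorUnitary : Matrix d d ℂ) * ρ * hA.eigenvectorUnitary) i i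
        = 0 := by
      rw [Matrix.mul_assoc, Matrix.mul_apply]
      refine Finset.sum_eq_zero fun j _ => ?_
      have : (ρ * (hA.eigenvectorUnitary : Matrix d d ℂ)) j i = 0 := congrFun hv j
      rw [this, mul_zero]
    simp [h0]
  · refine Tendsto.mul_const _ ?_
    have hc : ContinuousAt (fun ε : ℝ => Real.logb 2 (hA.eigenvalues i + ε)) 0 :=
      ((Real.continuousAt_log (by simpa using hi)).comp
        (continuousAt_const.add continuousAt_id)).div_const _
    have := hc.tendsto
    rw [add_zero] at this
    exact this.mono_left nhdsWithin_le_nhds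

lemma hermCFC_logb_add {A : Matrix d d ℂ} (hA : A.PosSemidef) (ε : ℝ) :
    hermCFC (fun x => Real.logb 2 (x + ε)) A =
      (Real.log 2)⁻¹ • CFC.log (A + algebraMap ℝ (Matrix d d ℂ) ε) := by
  have hfin (g : ℝ → ℝ) (s : Set ℝ) (hs : s.Finite) : ContinuousOn g s := hs.continuousOn g
  have hA' : IsSelfAdjoint A := hA.isHermitian
  have hspec : (spectrum ℝ A).Finite := Matrix.finite_real_spectrum
  have h1 : A + algebraMap ℝ (Matrix d d ℂ) ε = cfc (fun x : ℝ => x + ε) A := by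
    rw [cfc_add_const ε (fun x : ℝ => x) A, cfc_id' ℝ A]
  rw [hermCFC_eq_cfc _ hA.isHermitian, h1, CFC.log,
    ← cfc_comp' Real.log (fun x : ℝ => x + ε) A (hfin _ _ (hspec.image _)) (hfin _ _ hspec),
    ← cfc_smul (Real.log 2)⁻¹ _ A (hfin _ _ hspec)]
  congr 1
  ext x
  simp [Real.logb, div_eq_inv_mul]

lemma isStrictlyPositive_add_algebraMap {A : Matrix d d ℂ} (hA : A.PosSemidef) {ε : ℝ}
    (hε : 0 < ε) : IsStrictlyPositive (A + algebraMap ℝ (Matrix d d ℂ) ε) := by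
  rw [Matrix.isStrictlyPositive_iff_posDef, Algebra.algebraMap_eq_smul_one]
  exact Matrix.PosDef.posSemidef_add hA (Matrix.PosDef.one.smul hε)

/-- Operator monotonicity of the logarithm, paired with a state supported in both arguments. -/
lemma re_trace_mul_matLog2_le {ρ A B : Matrix d d ℂ} (hρ : ρ.PosSemidef) (hA : A.PosSemidef)
    (hB : B.PosSemidef) (hρA : SupportLE ρ A) (hρB : SupportLE ρ B) {c : ℝ} (hc : 1 ≤ c)
    (hAB : (c • B - A).PosSemidef) :
    (ρ * matLog2 A).trace.re ≤ Real.logb 2 c * ρ.trace.re + (ρ * matLog2 B).trace.re := by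
  refine le_of_tendsto_of_tendsto (tendsto_re_trace_mul_matLog2 hA.isHermitian hρA)
    ((tendsto_re_trace_mul_matLog2 hB.isHermitian hρB).const_add _) ?_
  filter_upwards [self_mem_nhdsWithin] with ε hε
  have hε : 0 < ε := hε
  have hc0 : 0 < c := by linarith
  have hle : A + algebraMap ℝ (Matrix d d ℂ) ε ≤ c • (B + algebraMap ℝ (Matrix d d ℂ) ε) := by
    rw [Matrix.le_iff, Algebra.algebraMap_eq_smul_one]
    have h2 : (((c - 1) * ε) • (1 : Matrix d d ℂ)).PosSemidef :=
      Matrix.PosSemidef.one.smul (mul_nonneg (by linarith) hε.le)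
    have h3 : c • (B + ε • (1 : Matrix d d ℂ)) - (A + ε • 1) =
        (c • B - A) + ((c - 1) * ε) • (1 : Matrix d d ℂ) := by
      module
    rw [h3]
    exact hAB.add h2
  have hlog := CFC.log_le_log hle (isStrictlyPositive_add_algebraMap hA hε)
  rw [CFC.log_smul' _ hc0 (isStrictlyPositive_add_algebraMap hB hε)] at hlog
  have hmono := hρ.re_trace_mul_le hlog
  have hlog2 : 0 < Real.log 2 := Real.log_pos one_lt_two
  rw [hermCFC_logb_add hA ε, hermCFC_logb_add hB ε]
  simp only [Matrix.mul_smul, Matrix.trace_smul, Complex.smul_re, smul_eq_mul,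
    Algebra.algebraMap_eq_smul_one, Matrix.mul_add, Matrix.trace_add, Complex.add_re,
    Matrix.mul_one] at hmono ⊢
  rw [Real.logb, div_eq_inv_mul, mul_assoc, ← mul_add]
  exact mul_le_mul_of_nonneg_left hmono (inv_nonneg.mpr hlog2.le)

end LogarithmMonotonicity

/-- If ρ_PQ ≤ 2^k·(ρ_P ⊗ σ_Q) and τ_PQ := (1/n)·ρ_PQ + ((n−1)/n)·ρ_P ⊗ σ_Q, then
D(ρ_PQ ‖ τ_PQ) ≥ D(ρ_PQ ‖ ρ_P ⊗ σ_Q) − log(1 + 2^k/n). -/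
theorem relent_mixture_lower_bound {P Q : Type} [Fintype P] [Fintype Q]
    [DecidableEq P] [DecidableEq Q] [Nonempty P] [Nonempty Q]
    (ρ : Matrix (P × Q) (P × Q) ℂ) (hρ : IsDensityMatrix ρ)
    (σ : Matrix Q Q ℂ) (hσ : IsDensityMatrix σ)
    (n : ℕ) (hn : 1 ≤ n)
    (k : ℝ) (hk : LoewnerLE ρ (((2 : ℝ) ^ k) • (ptrace2 ρ ⊗ₖ σ))) :
    relent ρ (((n : ℂ)⁻¹) • ρ + (((n : ℂ) - 1) / (n : ℂ)) • (ptrace2 ρ ⊗ₖ σ)) ≥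
      relent ρ (ptrace2 ρ ⊗ₖ σ)
        - ((Real.logb 2 (1 + (2 : ℝ) ^ k / (n : ℝ)) : ℝ) : EReal) := by
  set S := ptrace2 ρ ⊗ₖ σ with hSdef
  have hS : S.PosSemidef := hρ.1.ptrace2.kronecker hσ.1
  have hn0 : (0 : ℝ) < n := by exact_mod_cast hn
  have hn1 : (1 : ℝ) ≤ n := by exact_mod_cast hn
  have hninv : (0 : ℝ) ≤ (n : ℝ)⁻¹ := inv_nonneg.mpr hn0.le
  have h2k : (0 : ℝ) < (2 : ℝ) ^ k := Real.rpow_pos_of_pos two_pos k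
  have hτ : ((n : ℂ)⁻¹) • ρ + (((n : ℂ) - 1) / (n : ℂ)) • S =
      ((n : ℝ)⁻¹) • ρ + (((n : ℝ) - 1) / (n : ℝ)) • S := by
    ext i j
    simp
  rw [hτ]
  set τ := ((n : ℝ)⁻¹) • ρ + (((n : ℝ) - 1) / (n : ℝ)) • S with hτdef
  have hw : 0 ≤ ((n : ℝ) - 1) / n := div_nonneg (by linarith) hn0.le
  have hτpos : τ.PosSemidef := (hρ.1.smul hninv).add (hS.smul hw)
  have hρS : SupportLE ρ S := supportLE_of_le_smul hρ.1 hk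
  have hρτ : SupportLE ρ τ := by
    refine supportLE_of_le_smul (t := n) hρ.1 ?_
    have h : (n : ℝ) • τ - ρ = ((n : ℝ) - 1) • S := by
      rw [hτdef, smul_add, smul_smul, smul_smul, mul_inv_cancel₀ hn0.ne',
        mul_div_cancel₀ _ hn0.ne', one_smul, add_sub_cancel_left]
    rw [h]
    exact hS.smul (by linarith)
  have hτS : ((1 + (2 : ℝ) ^ k / n) • S - τ).PosSemidef := by
    have h : (1 + (2 : ℝ) ^ k / n) • S - τ =
        (n : ℝ)⁻¹ • ((2 : ℝ) ^ k • S - ρ) + (n : ℝ)⁻¹ • S := by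
      have hw' : ((n : ℝ) - 1) / n = 1 - (n : ℝ)⁻¹ := by field_simp
      rw [hτdef, hw', div_eq_mul_inv]
      module
    rw [h]
    exact (Matrix.PosSemidef.smul hk hninv).add (hS.smul hninv)
  have hmain := re_trace_mul_matLog2_le hρ.1 hτpos hS hρτ hρS
    (le_add_of_nonneg_right (div_nonneg h2k.le hn0.le)) hτS
  rw [hρ.2, Complex.one_re, mul_one] at hmain
  rw [relent, relent, if_pos hρS, if_pos hρτ, ge_iff_le, ← EReal.coe_sub, EReal.coe_le_coe_iff,
    relentR, relentR, Complex.sub_re, Complex.sub_re]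
  linarith

end
end

section
/- Let ρ_PQ be a density matrix on P×Q, σ_Q a density matrix on Q, δ ∈ (0,1), n ≥ 1 a natural number, and k ≥ 0 a real number such that ρ_PQ ≤ 2^k·(ρ_P ⊗ σ_Q). Let τ_{Q₁…Qₙ} be the marginal on Q₁×…×Qₙ of the convex-split state τ on P×Q₁×…×Qₙ. Then D(ρ_{PQₙ} ⊗ σ_{Q₁} ⊗ … ⊗ σ_{Q_{n−1}} ‖ ρ_P ⊗ τ_{Q₁…Qₙ}) ≤ D(ρ_PQ ‖ ρ_P ⊗ σ_Q) + log(1/(1−δ)) + log(n)·exp(−δ²·2^{−k}·(n−1)/2), where ρ_{PQₙ} ⊗ σ_{Q₁} ⊗ … ⊗ σ_{Q_{n−1}} denotes the state placing ρ_PQ on P and the n-th copy of Q and σ_Q on each of the other n−1 copies, and exp is the natural exponential. -/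
open scoped Kronecker BigOperators
open Matrix
open scoped ComplexOrder Classical

noncomputable section

section HermitianFunctionalCalculus

variable {d d' : Type*} [Fintype d] [DecidableEq d] [Fintype d'] [DecidableEq d']

/-- The functional calculus may be computed in any diagonalizing basis. -/
lemma hermCFC_of_diagonalization (f : ℝ → ℝ) {A U : Matrix d d ℂ} {a : d → ℝ}
    (hU : U ∈ Matrix.unitaryGroup d ℂ)
    (hA : A = U * Matrix.diagonal (fun i => (a i : ℂ)) * star U) :
    hermCFC f A = U * Matrix.diagonal (fun i => (f (a i) : ℂ)) * star U := by
  have hAh : A.IsHermitian := by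
    rw [hA]
    simp [Matrix.IsHermitian, Matrix.conjTranspose_mul, Matrix.star_eq_conjTranspose,
      Matrix.mul_assoc, Matrix.diagonal_conjTranspose, Pi.star_def]
  rw [hermCFC, dif_pos hAh]
  set V : Matrix d d ℂ := (hAh.eigenvectorUnitary : Matrix d d ℂ) with hV
  have hVmem : V ∈ Matrix.unitaryGroup d ℂ := hAh.eigenvectorUnitary.2
  have hspec : A = V * Matrix.diagonal (fun i => (hAh.eigenvalues i : ℂ)) * star V := by
    conv_lhs => rw [hAh.spectral_theorem]
    rfl
  have hUU := Matrix.mem_unitaryGroup_iff'.1 hU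
  have hUU' := Matrix.mem_unitaryGroup_iff.1 hU
  have hVV := Matrix.mem_unitaryGroup_iff'.1 hVmem
  have hVV' := Matrix.mem_unitaryGroup_iff.1 hVmem
  have hcomm : star V * U * Matrix.diagonal (fun i => (a i : ℂ)) =
      Matrix.diagonal (fun i => (hAh.eigenvalues i : ℂ)) * (star V * U) := by
    calc star V * U * Matrix.diagonal (fun i => (a i : ℂ))
        = star V * (U * Matrix.diagonal (fun i => (a i : ℂ)) * star U) * U := by
          simp only [Matrix.mul_assoc, hUU, Matrix.mul_one]
      _ = star V * (V * Matrix.diagonal (fun i => (hAh.eigenvalues i : ℂ)) * star V) * U := by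
          rw [← hA, ← hspec]
      _ = _ := by
          simp only [← Matrix.mul_assoc, hVV, Matrix.one_mul]
  have hcomm' : star V * U * Matrix.diagonal (fun i => (f (a i) : ℂ)) =
      Matrix.diagonal (fun i => (f (hAh.eigenvalues i) : ℂ)) * (star V * U) := by
    ext i j
    have h := congrFun (congrFun hcomm i) j
    rw [Matrix.mul_diagonal, Matrix.diagonal_mul] at h ⊢
    by_cases hw : (star V * U) i j = 0
    · simp [hw]
    · have : a j = hAh.eigenvalues i := by
        rw [mul_comm] at h
        exact_mod_cast mul_right_cancel₀ hw h
      rw [this, mul_comm]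
  calc V * Matrix.diagonal (fun i => (f (hAh.eigenvalues i) : ℂ)) * star V
      = V * (Matrix.diagonal (fun i => (f (hAh.eigenvalues i) : ℂ)) * (star V * U)) * star U := by
        simp only [Matrix.mul_assoc, hUU', Matrix.mul_one]
    _ = _ := by
        rw [← hcomm']
        simp only [← Matrix.mul_assoc, hVV', Matrix.one_mul]

lemma Matrix.IsHermitian.exists_diagonalization {A : Matrix d d ℂ} (hA : A.IsHermitian) :
    ∃ U ∈ Matrix.unitaryGroup d ℂ,
      A = U * Matrix.diagonal (fun i => (hA.eigenvalues i : ℂ)) * star U :=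
  ⟨_, hA.eigenvectorUnitary.2, hA.spectral_theorem⟩

lemma hermCFC_mul (f g : ℝ → ℝ) {A : Matrix d d ℂ} (hA : A.IsHermitian) :
    hermCFC f A * hermCFC g A = hermCFC (fun x => f x * g x) A := by
  obtain ⟨U, hU, h⟩ := hA.exists_diagonalization
  rw [hermCFC_of_diagonalization f hU h, hermCFC_of_diagonalization g hU h,
    hermCFC_of_diagonalization _ hU h]
  have hUU := Matrix.mem_unitaryGroup_iff'.1 hU
  simp only [Matrix.mul_assoc]
  rw [← Matrix.mul_assoc (star U) U, hUU, Matrix.one_mul, ← Matrix.mul_assoc (Matrix.diagonal _),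
    Matrix.diagonal_mul_diagonal]
  simp

lemma hermCFC_id {A : Matrix d d ℂ} (hA : A.IsHermitian) : hermCFC (fun x => x) A = A := by
  obtain ⟨U, hU, h⟩ := hA.exists_diagonalization
  rw [hermCFC_of_diagonalization _ hU h, ← h]

lemma hermCFC_one {A : Matrix d d ℂ} (hA : A.IsHermitian) : hermCFC (fun _ => 1) A = 1 := by
  obtain ⟨U, hU, h⟩ := hA.exists_diagonalization
  rw [hermCFC_of_diagonalization _ hU h]
  simp [Matrix.mem_unitaryGroup_iff.1 hU]

lemma hermCFC_zero {A : Matrix d d ℂ} (hA : A.IsHermitian) : hermCFC (fun _ => 0) A = 0 := by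
  obtain ⟨U, hU, h⟩ := hA.exists_diagonalization
  rw [hermCFC_of_diagonalization _ hU h]
  simp

lemma hermCFC_isHermitian (f : ℝ → ℝ) {A : Matrix d d ℂ} (hA : A.IsHermitian) :
    (hermCFC f A).IsHermitian := by
  obtain ⟨U, hU, h⟩ := hA.exists_diagonalization
  rw [hermCFC_of_diagonalization f hU h]
  simp [Matrix.IsHermitian, Matrix.conjTranspose_mul, Matrix.star_eq_conjTranspose,
    Matrix.mul_assoc, Matrix.diagonal_conjTranspose, Pi.star_def]

lemma hermCFC_submatrix (f : ℝ → ℝ) {A : Matrix d d ℂ} (hA : A.IsHermitian) (e : d' ≃ d) :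
    hermCFC f (A.submatrix e e) = (hermCFC f A).submatrix e e := by
  obtain ⟨U, hU, h⟩ := hA.exists_diagonalization
  have hU' : U.submatrix e e ∈ Matrix.unitaryGroup d' ℂ := by
    rw [Matrix.mem_unitaryGroup_iff, Matrix.star_eq_conjTranspose, Matrix.conjTranspose_submatrix,
      Matrix.submatrix_mul_equiv, ← Matrix.star_eq_conjTranspose, Matrix.mem_unitaryGroup_iff.1 hU,
      Matrix.submatrix_one_equiv]
  have key : ∀ a : d → ℝ, (U * Matrix.diagonal (fun i => (a i : ℂ)) * star U).submatrix e e =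
      U.submatrix e e * Matrix.diagonal (fun i => (a (e i) : ℂ)) * star (U.submatrix e e) := by
    intro a
    rw [Matrix.star_eq_conjTranspose, Matrix.star_eq_conjTranspose,
      Matrix.conjTranspose_submatrix, ← Matrix.submatrix_mul_equiv _ _ e e e,
      ← Matrix.submatrix_mul_equiv _ _ e e e, Matrix.submatrix_diagonal_equiv]
    rfl
  rw [hermCFC_of_diagonalization f hU h, key]
  refine hermCFC_of_diagonalization f hU' ?_
  rw [← key, ← h]

lemma hermCFC_kronecker {f : ℝ → ℝ} {f₁ g₁ f₂ g₂ : ℝ → ℝ}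
    (hf : ∀ x y, f (x * y) = f₁ x * g₁ y + f₂ x * g₂ y)
    {A : Matrix d d ℂ} {B : Matrix d' d' ℂ} (hA : A.IsHermitian) (hB : B.IsHermitian) :
    hermCFC f (A ⊗ₖ B) =
      hermCFC f₁ A ⊗ₖ hermCFC g₁ B + hermCFC f₂ A ⊗ₖ hermCFC g₂ B := by
  obtain ⟨U, hU, hUA⟩ := hA.exists_diagonalization
  obtain ⟨V, hV, hVB⟩ := hB.exists_diagonalization
  have hUV : U ⊗ₖ V ∈ Matrix.unitaryGroup (d × d') ℂ := Matrix.kronecker_mem_unitary hU hV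
  have key : ∀ (a : d → ℝ) (b : d' → ℝ),
      (U * Matrix.diagonal (fun i => (a i : ℂ)) * star U) ⊗ₖ
        (V * Matrix.diagonal (fun i => (b i : ℂ)) * star V) =
      (U ⊗ₖ V) * Matrix.diagonal (fun p : d × d' => ((a p.1 * b p.2 : ℝ) : ℂ)) *
        star (U ⊗ₖ V) := by
    intro a b
    rw [Matrix.mul_kronecker_mul, Matrix.mul_kronecker_mul, Matrix.diagonal_kronecker_diagonal]
    simp only [Matrix.star_eq_conjTranspose, Matrix.conjTranspose_kronecker, Complex.ofReal_mul]
  have hAB : A ⊗ₖ B = (U ⊗ₖ V) * Matrix.diagonal (fun p : d × d' =>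
      ((hA.eigenvalues p.1 * hB.eigenvalues p.2 : ℝ) : ℂ)) * star (U ⊗ₖ V) := by
    rw [← key, ← hUA, ← hVB]
  rw [hermCFC_of_diagonalization f hUV hAB, hermCFC_of_diagonalization f₁ hU hUA,
    hermCFC_of_diagonalization f₂ hU hUA, hermCFC_of_diagonalization g₁ hV hVB,
    hermCFC_of_diagonalization g₂ hV hVB, key, key, ← Matrix.add_mul, ← Matrix.mul_add,
    Matrix.diagonal_add]
  simp only [hf, Complex.ofReal_add]

/-- Traces of products of functional calculi, as sums against nonnegative overlap weights. -/
lemma exists_weights_trace_hermCFC_mul {A B : Matrix d d ℂ} (hA : A.IsHermitian)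
    (hB : B.IsHermitian) :
    ∃ w : d → d → ℝ, (∀ i j, 0 ≤ w i j) ∧ ∀ f g : ℝ → ℝ,
      (hermCFC f A * hermCFC g B).trace =
        ((∑ i, ∑ j, w i j * (f (hA.eigenvalues i) * g (hB.eigenvalues j)) : ℝ) : ℂ) := by
  obtain ⟨U, hU, hUA⟩ := hA.exists_diagonalization
  obtain ⟨V, hV, hVB⟩ := hB.exists_diagonalization
  refine ⟨fun i j => Complex.normSq ((star U * V) i j), fun i j => Complex.normSq_nonneg _, ?_⟩
  intro f g
  rw [hermCFC_of_diagonalization f hU hUA, hermCFC_of_diagonalization g hV hVB]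
  have hstar : star V * U = (star U * V)ᴴ := by
    simp [Matrix.star_eq_conjTranspose]
  calc _ = (Matrix.diagonal (fun i => (f (hA.eigenvalues i) : ℂ)) * (star U * V) *
          Matrix.diagonal (fun i => (g (hB.eigenvalues i) : ℂ)) * (star V * U)).trace := by
        simp only [Matrix.mul_assoc]
        rw [Matrix.trace_mul_comm]
        simp only [Matrix.mul_assoc]
    _ = _ := by
        rw [hstar, Matrix.trace]
        push_cast
        refine Finset.sum_congr rfl fun i _ => ?_
        rw [Matrix.diag_apply, Matrix.mul_apply]
        refine Finset.sum_congr rfl fun j _ => ?_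
        rw [Matrix.mul_diagonal, Matrix.diagonal_mul, Matrix.conjTranspose_apply,
          Complex.normSq_eq_conj_mul_self, Complex.star_def]
        ring

end HermitianFunctionalCalculus

section Support

variable {d d' : Type*} [Fintype d] [Fintype d']

lemma SupportLE.trans {A B C : Matrix d d ℂ} (hAB : SupportLE A B) (hBC : SupportLE B C) :
    SupportLE A C := fun v hv => hAB v (hBC v hv)

lemma SupportLE.mul_eq_zero {A B X : Matrix d d ℂ} (h : SupportLE A B) (hX : B * X = 0) :
    A * X = 0 := by
  ext i j
  have h1 : B *ᵥ (fun k => X k j) = 0 := by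
    ext i
    exact congrFun (congrFun hX i) j
  exact congrFun (h _ h1) i

lemma supportLE_of_mul_eq {A B C : Matrix d d ℂ} (h : A = C * B) : SupportLE A B := by
  intro v hv
  rw [h, ← Matrix.mulVec_mulVec, hv, Matrix.mulVec_zero]

lemma supportLE_of_loewnerLE_smul {A B : Matrix d d ℂ} {c : ℝ} (hA : A.PosSemidef)
    (h : LoewnerLE A (c • B)) : SupportLE A B := by
  classical
  intro v hv
  rw [← hA.dotProduct_mulVec_zero_iff]
  refine le_antisymm ?_ (hA.dotProduct_mulVec_nonneg v)
  have := Matrix.PosSemidef.dotProduct_mulVec_nonneg h v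
  rw [Matrix.sub_mulVec, Matrix.smul_mulVec, hv, smul_zero, zero_sub, dotProduct_neg] at this
  exact neg_nonneg.1 this

lemma Matrix.PosSemidef.mul_eq_zero_of_trace {M N : Matrix d d ℂ} (hM : M.PosSemidef)
    (hN : N.IsHermitian) (hNN : N * N = N) (h : (M * N).trace = 0) : M * N = 0 := by
  classical
  have hP : (N * M * N).PosSemidef := by
    have := hM.conjTranspose_mul_mul_same N
    rwa [hN.eq] at this
  have htr : (N * M * N).trace = 0 := by
    rw [Matrix.mul_assoc, Matrix.trace_mul_comm, Matrix.mul_assoc, hNN, h]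
  have h0 := hP.trace_eq_zero_iff.1 htr
  ext i j
  have h1 : M *ᵥ (fun k => N k j) = 0 := by
    rw [← hM.dotProduct_mulVec_zero_iff]
    have h2 := congrFun (congrFun h0 j) j
    have h3 : ∀ k, star (N k j) = N j k := fun k => hN.apply j k
    rw [Matrix.mul_assoc, Matrix.mul_apply, Matrix.zero_apply] at h2
    rw [← h2]
    simp only [dotProduct, Pi.star_apply, h3]
    rfl
  exact congrFun h1 i

end Support

section PartialTrace

variable {d d' : Type*}

lemma sub_kronecker (A B : Matrix d d ℂ) (C : Matrix d' d' ℂ) :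
    (A - B) ⊗ₖ C = A ⊗ₖ C - B ⊗ₖ C := by
  ext
  simp [sub_mul]

lemma kronecker_sub (A : Matrix d d ℂ) (B C : Matrix d' d' ℂ) :
    A ⊗ₖ (B - C) = A ⊗ₖ B - A ⊗ₖ C := by
  ext
  simp [mul_sub]

lemma trace_mul_kronecker_one [Fintype d] [Fintype d'] [DecidableEq d']
    (M : Matrix (d × d') (d × d') ℂ) (X : Matrix d d ℂ) :
    (M * (X ⊗ₖ (1 : Matrix d' d' ℂ))).trace = (ptrace2 M * X).trace := by
  simp only [Matrix.trace, Matrix.diag_apply, Matrix.mul_apply, ptrace2, Fintype.sum_prod_type,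
    Matrix.kroneckerMap_apply, Matrix.one_apply, mul_ite, mul_one, mul_zero, Finset.sum_ite_eq',
    Finset.mem_univ, if_true, Finset.sum_mul]
  exact Finset.sum_congr rfl fun i _ => Finset.sum_comm

lemma trace_mul_one_kronecker [Fintype d] [DecidableEq d] [Fintype d']
    (M : Matrix (d × d') (d × d') ℂ) (X : Matrix d' d' ℂ) :
    (M * ((1 : Matrix d d ℂ) ⊗ₖ X)).trace = (ptrace1 M * X).trace := by
  simp only [Matrix.trace, Matrix.diag_apply, Matrix.mul_apply, ptrace1, Fintype.sum_prod_type,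
    Matrix.kroneckerMap_apply, Matrix.one_apply, ite_mul, one_mul, zero_mul, mul_ite, mul_zero,
    Finset.sum_mul]
  rw [Finset.sum_comm]
  refine Finset.sum_congr rfl fun i _ => ?_
  rw [Finset.sum_comm]
  conv_rhs => rw [Finset.sum_comm]
  rw [Finset.sum_comm]
  refine Finset.sum_congr rfl fun k _ => ?_
  rw [Finset.sum_comm]
  simp

lemma ptrace2_posSemidef [Fintype d'] {M : Matrix (d × d') (d × d') ℂ} (hM : M.PosSemidef) :
    (ptrace2 M).PosSemidef := by
  have : ptrace2 M = ∑ k, M.submatrix (fun i => (i, k)) (fun i => (i, k)) := by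
    ext i j
    simp [ptrace2, Matrix.sum_apply]
  rw [this]
  exact Matrix.posSemidef_sum _ fun k _ => hM.submatrix _

lemma ptrace1_posSemidef [Fintype d] {M : Matrix (d × d') (d × d') ℂ} (hM : M.PosSemidef) :
    (ptrace1 M).PosSemidef := by
  have : ptrace1 M = ∑ k, M.submatrix (fun i => (k, i)) (fun i => (k, i)) := by
    ext i j
    simp [ptrace1, Matrix.sum_apply]
  rw [this]
  exact Matrix.posSemidef_sum _ fun k _ => hM.submatrix _

lemma trace_ptrace2 [Fintype d] [Fintype d'] (M : Matrix (d × d') (d × d') ℂ) :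
    (ptrace2 M).trace = M.trace := by
  simp [Matrix.trace, ptrace2, Fintype.sum_prod_type]

lemma trace_ptrace1 [Fintype d] [Fintype d'] (M : Matrix (d × d') (d × d') ℂ) :
    (ptrace1 M).trace = M.trace := by
  simp only [Matrix.trace, ptrace1, Fintype.sum_prod_type, Matrix.diag_apply]
  exact Finset.sum_comm

lemma ptrace2_kronecker [Fintype d'] (A : Matrix d d ℂ) (B : Matrix d' d' ℂ) :
    ptrace2 (A ⊗ₖ B) = B.trace • A := by
  ext i j
  simp [ptrace2, ← Finset.mul_sum, Matrix.trace, mul_comm]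

lemma ptrace1_kronecker [Fintype d] (A : Matrix d d ℂ) (B : Matrix d' d' ℂ) :
    ptrace1 (A ⊗ₖ B) = A.trace • B := by
  ext i j
  simp [ptrace1, ← Finset.sum_mul, Matrix.trace]

variable [Fintype d] [DecidableEq d] [Fintype d'] [DecidableEq d']

/-- The projection onto the support of a Hermitian matrix. -/
def supportProj (A : Matrix d d ℂ) : Matrix d d ℂ := hermCFC (fun x => if x = 0 then 0 else 1) A

lemma self_mul_supportProj {A : Matrix d d ℂ} (hA : A.IsHermitian) : A * supportProj A = A := by
  conv_lhs => enter [1]; rw [← hermCFC_id hA]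
  rw [supportProj, hermCFC_mul _ _ hA]
  conv_rhs => rw [← hermCFC_id hA]
  congr 1
  ext x
  by_cases h : x = 0 <;> simp [h]

lemma supportProj_mul_matLog2 {A : Matrix d d ℂ} (hA : A.IsHermitian) :
    supportProj A * matLog2 A = matLog2 A := by
  rw [supportProj, matLog2, hermCFC_mul _ _ hA]
  congr 1
  ext x
  by_cases h : x = 0 <;> simp [h]

lemma hermCFC_inv_mul_self {A : Matrix d d ℂ} (hA : A.IsHermitian) :
    hermCFC (fun x => x⁻¹) A * A = supportProj A := by
  conv_lhs => enter [2]; rw [← hermCFC_id hA]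
  rw [supportProj, hermCFC_mul _ _ hA]
  congr 1
  ext x
  by_cases h : x = 0 <;> simp [h]

lemma one_sub_supportProj_isHermitian {A : Matrix d d ℂ} (hA : A.IsHermitian) :
    (1 - supportProj A).IsHermitian :=
  Matrix.isHermitian_one.sub (hermCFC_isHermitian _ hA)

lemma one_sub_supportProj_mul_self {A : Matrix d d ℂ} (hA : A.IsHermitian) :
    (1 - supportProj A) * (1 - supportProj A) = 1 - supportProj A := by
  have : supportProj A * supportProj A = supportProj A := by
    rw [supportProj, hermCFC_mul _ _ hA]
    congr 1
    ext x
    by_cases h : x = 0 <;> simp [h]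
  simp [Matrix.sub_mul, Matrix.mul_sub, this]

lemma mul_supportProj_kronecker {M : Matrix (d × d') (d × d') ℂ} {A : Matrix d d ℂ}
    {B : Matrix d' d' ℂ} (hA : A.IsHermitian) (hB : B.IsHermitian)
    (h : SupportLE M (A ⊗ₖ B)) : M * (supportProj A ⊗ₖ supportProj B) = M := by
  have h0 : (A ⊗ₖ B) * (1 - supportProj A ⊗ₖ supportProj B) = 0 := by
    rw [Matrix.mul_sub, ← Matrix.mul_kronecker_mul, self_mul_supportProj hA,
      self_mul_supportProj hB, Matrix.mul_one, sub_self]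
  have h1 := h.mul_eq_zero h0
  rw [Matrix.mul_sub, Matrix.mul_one, sub_eq_zero] at h1
  exact h1.symm

/-- The support of a positive semidefinite matrix lies in the product of the supports of its
marginals. -/
lemma supportLE_ptrace_kronecker {M : Matrix (d × d') (d × d') ℂ} (hM : M.PosSemidef) :
    SupportLE M (ptrace2 M ⊗ₖ ptrace1 M) := by
  have hA := (ptrace2_posSemidef hM).isHermitian
  have hB := (ptrace1_posSemidef hM).isHermitian
  set A := ptrace2 M with hAdef
  set B := ptrace1 M with hBdef
  have hMA : M * (supportProj A ⊗ₖ 1) = M := by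
    have := hM.mul_eq_zero_of_trace (N := (1 - supportProj A) ⊗ₖ 1)
      (by rw [Matrix.IsHermitian, Matrix.conjTranspose_kronecker,
            (one_sub_supportProj_isHermitian hA).eq, Matrix.conjTranspose_one])
      (by rw [← Matrix.mul_kronecker_mul, one_sub_supportProj_mul_self hA, Matrix.mul_one])
      (by rw [trace_mul_kronecker_one, ← hAdef, Matrix.mul_sub, self_mul_supportProj hA]; simp)
    rw [sub_kronecker, Matrix.mul_sub, Matrix.one_kronecker_one, Matrix.mul_one,
      sub_eq_zero] at this
    exact this.symm
  have hMB : M * (1 ⊗ₖ supportProj B) = M := by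
    have := hM.mul_eq_zero_of_trace (N := 1 ⊗ₖ (1 - supportProj B))
      (by rw [Matrix.IsHermitian, Matrix.conjTranspose_kronecker,
            (one_sub_supportProj_isHermitian hB).eq, Matrix.conjTranspose_one])
      (by rw [← Matrix.mul_kronecker_mul, one_sub_supportProj_mul_self hB, Matrix.mul_one])
      (by rw [trace_mul_one_kronecker, ← hBdef, Matrix.mul_sub, self_mul_supportProj hB]; simp)
    rw [kronecker_sub, Matrix.mul_sub, Matrix.one_kronecker_one, Matrix.mul_one,
      sub_eq_zero] at this
    exact this.symm
  refine supportLE_of_mul_eq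
    (C := M * (hermCFC (fun x => x⁻¹) A ⊗ₖ hermCFC (fun x => x⁻¹) B)) ?_
  rw [Matrix.mul_assoc, ← Matrix.mul_kronecker_mul, hermCFC_inv_mul_self hA,
    hermCFC_inv_mul_self hB]
  conv_lhs => rw [← hMB, ← hMA]
  rw [Matrix.mul_assoc, ← Matrix.mul_kronecker_mul, Matrix.mul_one, Matrix.one_mul]

lemma matLog2_kronecker {A : Matrix d d ℂ} {B : Matrix d' d' ℂ} (hA : A.IsHermitian)
    (hB : B.IsHermitian) :
    matLog2 (A ⊗ₖ B) = matLog2 A ⊗ₖ supportProj B + supportProj A ⊗ₖ matLog2 B := by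
  refine hermCFC_kronecker (fun x y => ?_) hA hB
  by_cases hx : x = 0
  · simp [hx]
  by_cases hy : y = 0
  · simp [hy]
  simp [hx, hy, Real.logb_mul hx hy]

lemma trace_mul_matLog2_kronecker {M : Matrix (d × d') (d × d') ℂ} {A : Matrix d d ℂ}
    {B : Matrix d' d' ℂ} (hA : A.IsHermitian) (hB : B.IsHermitian)
    (h : SupportLE M (A ⊗ₖ B)) :
    (M * matLog2 (A ⊗ₖ B)).trace =
      (ptrace2 M * matLog2 A).trace + (ptrace1 M * matLog2 B).trace := by
  have hM := mul_supportProj_kronecker hA hB h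
  have hleft : M * (matLog2 A ⊗ₖ supportProj B) = M * (matLog2 A ⊗ₖ (1 : Matrix d' d' ℂ)) := by
    conv_rhs => rw [← hM]
    rw [Matrix.mul_assoc, ← Matrix.mul_kronecker_mul, supportProj_mul_matLog2 hA, Matrix.mul_one]
  have hright : M * (supportProj A ⊗ₖ matLog2 B) = M * ((1 : Matrix d d ℂ) ⊗ₖ matLog2 B) := by
    conv_rhs => rw [← hM]
    rw [Matrix.mul_assoc, ← Matrix.mul_kronecker_mul, supportProj_mul_matLog2 hB, Matrix.mul_one]
  rw [← trace_mul_kronecker_one, ← trace_mul_one_kronecker, matLog2_kronecker hA hB,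
    Matrix.mul_add, Matrix.trace_add, hleft, hright]

end PartialTrace

section Klein

variable {d : Type*} [Fintype d] [DecidableEq d]

/-- Klein's inequality. -/
lemma trace_mul_matLog2_le {A B : Matrix d d ℂ} (hA : A.PosSemidef) (hB : B.PosSemidef)
    (htr : A.trace = B.trace) (h : SupportLE A B) :
    (A * matLog2 B).trace.re ≤ (A * matLog2 A).trace.re := by
  have hAh := hA.isHermitian
  have hBh := hB.isHermitian
  obtain ⟨w, hw, key⟩ := exists_weights_trace_hermCFC_mul hAh hBh
  set a := hAh.eigenvalues
  set b := hBh.eigenvalues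
  have ha : ∀ i, 0 ≤ a i := hA.eigenvalues_nonneg
  have hb : ∀ i, 0 ≤ b i := hB.eigenvalues_nonneg
  have hAB : (A * matLog2 B).trace = ((∑ i, ∑ j, w i j * (a i * Real.logb 2 (b j)) : ℝ) : ℂ) := by
    rw [← key (fun x => x) (Real.logb 2), hermCFC_id hAh, matLog2]
  have hAA : (A * matLog2 A).trace =
      ((∑ i, ∑ j, w i j * (a i * Real.logb 2 (a i) * 1) : ℝ) : ℂ) := by
    rw [← key (fun x => x * Real.logb 2 x) (fun _ => 1), hermCFC_one hBh,
      ← hermCFC_mul (fun x => x) (Real.logb 2) hAh, hermCFC_id hAh, matLog2, Matrix.mul_one]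
  have hsum : ∑ i, ∑ j, w i j * (a i * 1) = ∑ i, ∑ j, w i j * (1 * b j) := by
    have h1 := key (fun x => x) (fun _ => 1)
    have h2 := key (fun _ => 1) (fun x => x)
    rw [hermCFC_id hAh, hermCFC_one hBh, Matrix.mul_one] at h1
    rw [hermCFC_one hAh, hermCFC_id hBh, Matrix.one_mul] at h2
    rw [h1, h2] at htr
    exact_mod_cast htr
  have hvanish : ∀ i j, b j = 0 → w i j * a i = 0 := by
    have h0 : A * hermCFC (fun x => if x = 0 then 1 else 0) B = 0 := by
      refine h.mul_eq_zero ?_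
      conv_lhs => enter [1]; rw [← hermCFC_id hBh]
      rw [hermCFC_mul _ _ hBh, ← hermCFC_zero hBh]
      congr 1
      ext x
      by_cases hx : x = 0 <;> simp [hx]
    have h1 := key (fun x => x) (fun x => if x = 0 then 1 else 0)
    rw [hermCFC_id hAh, h0, Matrix.trace_zero] at h1
    have h2 : ∑ i, ∑ j, w i j * (a i * if b j = 0 then 1 else 0) = 0 := by
      exact_mod_cast h1.symm
    have hnn : ∀ i j, 0 ≤ w i j * (a i * if b j = 0 then 1 else 0) := fun i j =>
      mul_nonneg (hw i j) (mul_nonneg (ha i) (by split_ifs <;> norm_num))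
    intro i j hbj
    have h3 := (Finset.sum_eq_zero_iff_of_nonneg
      (fun i _ => Finset.sum_nonneg fun j _ => hnn i j)).1 h2 i (Finset.mem_univ i)
    have h4 := (Finset.sum_eq_zero_iff_of_nonneg fun j _ => hnn i j).1 h3 j (Finset.mem_univ j)
    simpa [hbj] using h4
  have hlog2 : 0 < Real.log 2 := Real.log_pos one_lt_two
  have hterm : ∀ i j, w i j * (a i * 1) - w i j * (1 * b j) ≤
      Real.log 2 * (w i j * (a i * Real.logb 2 (a i) * 1) -
        w i j * (a i * Real.logb 2 (b j))) := by
    intro i j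
    have hlogb : ∀ x, Real.log 2 * Real.logb 2 x = Real.log x := fun x => by
      rw [Real.logb, mul_div_cancel₀ _ hlog2.ne']
    have hrw : Real.log 2 * (w i j * (a i * Real.logb 2 (a i) * 1) -
        w i j * (a i * Real.logb 2 (b j))) =
        w i j * a i * (Real.log (a i) - Real.log (b j)) := by
      rw [← hlogb (a i), ← hlogb (b j)]
      ring
    rw [hrw]
    rcases (hb j).eq_or_lt with hbj | hbj
    · rw [hvanish i j hbj.symm, ← hbj]
      have := hvanish i j hbj.symm
      linarith
    rcases (ha i).eq_or_lt with hai | hai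
    · rw [← hai]
      have := mul_nonneg (hw i j) hbj.le
      simp only [zero_mul, mul_zero]
      linarith
    have h1 := Real.log_le_sub_one_of_pos (div_pos hbj hai)
    rw [Real.log_div hbj.ne' hai.ne'] at h1
    have h2 : a i - b j ≤ a i * (Real.log (a i) - Real.log (b j)) := by
      have h3 := mul_le_mul_of_nonneg_left h1 hai.le
      have h4 : a i * (b j / a i - 1) = b j - a i := by
        field_simp
      linarith
    have := mul_le_mul_of_nonneg_left h2 (hw i j)
    linarith
  have hfinal := Finset.sum_le_sum fun i (_ : i ∈ Finset.univ) =>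
    Finset.sum_le_sum fun j (_ : j ∈ Finset.univ) => hterm i j
  simp only [Finset.sum_sub_distrib, ← Finset.mul_sum] at hfinal
  rw [hAB, hAA, Complex.ofReal_re, Complex.ofReal_re]
  rw [hsum, sub_self] at hfinal
  have := nonneg_of_mul_nonneg_right hfinal hlog2
  linarith

end Klein

section TensorPower

variable {Q ι : Type*}

/-- The tensor power of a matrix over an index type `ι` of factors. -/
def tensorPower (ι : Type*) [Fintype ι] (σ : Matrix Q Q ℂ) : Matrix (ι → Q) (ι → Q) ℂ :=
  fun x y => ∏ i, σ (x i) (y i)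

lemma tensorPower_mul [Fintype Q] [Fintype ι] [DecidableEq ι] (A B : Matrix Q Q ℂ) :
    tensorPower ι (A * B) = tensorPower ι A * tensorPower ι B := by
  ext x y
  simp only [tensorPower, Matrix.mul_apply, ← Finset.prod_mul_distrib]
  rw [Finset.prod_univ_sum, Fintype.piFinset_univ]

lemma tensorPower_conjTranspose [Fintype ι] (A : Matrix Q Q ℂ) :
    tensorPower ι Aᴴ = (tensorPower ι A)ᴴ := by
  ext x y
  simp [tensorPower, Matrix.conjTranspose_apply]

lemma tensorPower_posSemidef [Fintype Q] [Fintype ι] [DecidableEq ι] {σ : Matrix Q Q ℂ}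
    (hσ : σ.PosSemidef) :
    (tensorPower ι σ).PosSemidef := by
  obtain ⟨C, rfl⟩ : ∃ C : Matrix Q Q ℂ, σ = Cᴴ * C := by
    open scoped MatrixOrder Matrix.Norms.L2Operator in
    exact CStarAlgebra.nonneg_iff_eq_star_mul_self.1 hσ.nonneg
  rw [tensorPower_mul, tensorPower_conjTranspose]
  exact Matrix.posSemidef_conjTranspose_mul_self _

lemma trace_tensorPower [Fintype Q] [Fintype ι] [DecidableEq ι] (σ : Matrix Q Q ℂ) :
    (tensorPower ι σ).trace = σ.trace ^ Fintype.card ι := by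
  simp only [Matrix.trace, Matrix.diag_apply, tensorPower]
  rw [← Finset.card_univ, ← Finset.prod_const, Finset.prod_univ_sum, Fintype.piFinset_univ]

lemma tensorPower_eq_submatrix [Fintype ι] [DecidableEq ι] (σ : Matrix Q Q ℂ) (j : ι) :
    tensorPower ι σ = (σ ⊗ₖ tensorPower {i // i ≠ j} σ).submatrix
      (Equiv.funSplitAt j Q) (Equiv.funSplitAt j Q) := by
  ext x y
  simp only [tensorPower, Matrix.submatrix_apply, Matrix.kroneckerMap_apply, Equiv.funSplitAt,
    Equiv.piSplitAt, Equiv.coe_fn_mk]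
  rw [← Finset.mul_prod_erase Finset.univ _ (Finset.mem_univ j)]
  congr 1
  exact (Finset.prod_subtype _ (by simp) _)

/-- The matrix `A` on factor `j` and `σ` on all other factors. -/
def siteState [Fintype ι] [DecidableEq ι] (A σ : Matrix Q Q ℂ) (j : ι) : Matrix (ι → Q) (ι → Q) ℂ :=
  fun x y => A (x j) (y j) * ∏ i ∈ Finset.univ.erase j, σ (x i) (y i)

lemma siteState_eq_submatrix [Fintype ι] [DecidableEq ι] (A σ : Matrix Q Q ℂ) (j : ι) :
    siteState A σ j = (A ⊗ₖ tensorPower {i // i ≠ j} σ).submatrix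
      (Equiv.funSplitAt j Q) (Equiv.funSplitAt j Q) := by
  ext x y
  simp only [siteState, tensorPower, Matrix.submatrix_apply, Matrix.kroneckerMap_apply,
    Equiv.funSplitAt, Equiv.piSplitAt, Equiv.coe_fn_mk]
  congr 1
  exact (Finset.prod_subtype _ (by simp) _)

/-- Relabelling of tensor factors by a permutation. -/
def relabel (Q : Type*) (π : Equiv.Perm ι) : (ι → Q) ≃ (ι → Q) := π.symm.arrowCongr (Equiv.refl Q)

lemma relabel_apply (π : Equiv.Perm ι) (x : ι → Q) (i : ι) : relabel Q π x i = x (π i) := rfl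

lemma siteState_relabel [Fintype ι] [DecidableEq ι] (A σ : Matrix Q Q ℂ)
    (π : Equiv.Perm ι) (j : ι) :
    (siteState A σ j).submatrix (relabel Q π) (relabel Q π) = siteState A σ (π j) := by
  ext x y
  simp only [siteState, Matrix.submatrix_apply, relabel_apply]
  congr 1
  refine Finset.prod_equiv π (by simp) (by simp)

lemma tensorPower_relabel [Fintype ι] (σ : Matrix Q Q ℂ) (π : Equiv.Perm ι) :
    (tensorPower ι σ).submatrix (relabel Q π) (relabel Q π) = tensorPower ι σ := by
  ext x y
  simp only [tensorPower, Matrix.submatrix_apply, relabel_apply]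
  exact Equiv.prod_comp π fun i => σ (x i) (y i)

lemma Matrix.trace_submatrix_equiv_equiv {d d' : Type*} [Fintype d] [Fintype d']
    (M : Matrix d d ℂ) (e : d' ≃ d) : (M.submatrix e e).trace = M.trace :=
  Equiv.sum_comp e fun i => M i i

/-- The uniform mixture of the site states. -/
def siteMean (ι : Type*) [Fintype ι] [DecidableEq ι] (A σ : Matrix Q Q ℂ) :
    Matrix (ι → Q) (ι → Q) ℂ :=
  ((Fintype.card ι : ℂ)⁻¹) • ∑ j, siteState A σ j

lemma siteMean_relabel [Fintype ι] [DecidableEq ι] (A σ : Matrix Q Q ℂ) (π : Equiv.Perm ι) :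
    (siteMean ι A σ).submatrix (relabel Q π) (relabel Q π) = siteMean ι A σ := by
  have h : (∑ j, siteState A σ j).submatrix (relabel Q π) (relabel Q π) =
      ∑ j, siteState A σ (π j) := by
    simp only [← siteState_relabel]
    ext x y
    simp [Matrix.sum_apply]
  change ((Fintype.card ι : ℂ)⁻¹) • (∑ j, siteState A σ j).submatrix _ _ = _
  rw [h, siteMean]
  congr 1
  exact Equiv.sum_comp π fun j => siteState A σ j

variable [Fintype Q] [Fintype ι] [DecidableEq ι]

lemma siteState_posSemidef {A σ : Matrix Q Q ℂ} (hA : A.PosSemidef) (hσ : σ.PosSemidef) (j : ι) :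
    (siteState A σ j).PosSemidef := by
  rw [siteState_eq_submatrix]
  exact (hA.kronecker (tensorPower_posSemidef hσ)).submatrix _

lemma trace_siteState (A σ : Matrix Q Q ℂ) (hσ : σ.trace = 1) (j : ι) :
    (siteState A σ j).trace = A.trace := by
  rw [siteState_eq_submatrix, Matrix.trace_submatrix_equiv_equiv, Matrix.trace_kronecker,
    trace_tensorPower, hσ, one_pow, mul_one]

lemma card_inv_nonneg {ι : Type*} [Fintype ι] : (0 : ℂ) ≤ (Fintype.card ι : ℂ)⁻¹ := by
  rw [← Complex.ofReal_natCast, ← Complex.ofReal_inv, Complex.zero_le_real]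
  positivity

lemma siteMean_posSemidef {A σ : Matrix Q Q ℂ} (hA : A.PosSemidef) (hσ : σ.PosSemidef) :
    (siteMean ι A σ).PosSemidef :=
  (Matrix.posSemidef_sum _ fun j _ => siteState_posSemidef hA hσ j).smul card_inv_nonneg

lemma trace_siteMean [Nonempty ι] (A σ : Matrix Q Q ℂ) (hσ : σ.trace = 1) :
    (siteMean ι A σ).trace = A.trace := by
  rw [siteMean, Matrix.trace_smul, Matrix.trace_sum]
  simp [trace_siteState A σ hσ]

/-- A permutation invariant observable cannot tell a site state from the uniform mixture. -/
lemma trace_siteMean_mul [Nonempty ι] (A σ : Matrix Q Q ℂ) {L : Matrix (ι → Q) (ι → Q) ℂ}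
    (hL : ∀ π : Equiv.Perm ι, L.submatrix (relabel Q π) (relabel Q π) = L) (j : ι) :
    (siteMean ι A σ * L).trace = (siteState A σ j * L).trace := by
  have h : ∀ i, (siteState A σ i * L).trace = (siteState A σ j * L).trace := by
    intro i
    conv_rhs => rw [← Equiv.swap_apply_left i j, ← siteState_relabel, ← hL (Equiv.swap i j)]
    rw [Matrix.submatrix_mul_equiv, Matrix.trace_submatrix_equiv_equiv]
  rw [siteMean, Matrix.smul_mul, Matrix.sum_mul, Matrix.trace_smul, Matrix.trace_sum,
    Finset.sum_congr rfl fun i _ => h i]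
  simp

lemma card_smul_siteMean_sub_siteState_posSemidef [Nonempty ι] {A σ : Matrix Q Q ℂ}
    (hA : A.PosSemidef)
    (hσ : σ.PosSemidef) (j : ι) :
    (Fintype.card ι • siteMean ι A σ - siteState A σ j).PosSemidef := by
  have : Fintype.card ι • siteMean ι A σ - siteState A σ j =
      ∑ i ∈ Finset.univ.erase j, siteState A σ i := by
    rw [siteMean, ← Nat.cast_smul_eq_nsmul ℂ, smul_smul, mul_inv_cancel₀ (by simp), one_smul,
      sub_eq_iff_eq_add, Finset.sum_erase_add _ _ (Finset.mem_univ j)]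
  rw [this]
  exact Matrix.posSemidef_sum _ fun i _ => siteState_posSemidef hA hσ i

lemma supportLE_siteMean_tensorPower [Nonempty ι] {A σ : Matrix Q Q ℂ} {c : ℝ}
    (hA : A.PosSemidef) (hσ : σ.PosSemidef) (h : LoewnerLE A (c • σ)) :
    SupportLE (siteMean ι A σ) (tensorPower ι σ) := by
  refine supportLE_of_loewnerLE_smul (c := c) (siteMean_posSemidef hA hσ) ?_
  have hj : ∀ j : ι, (c • tensorPower ι σ - siteState A σ j).PosSemidef := by
    intro j
    rw [tensorPower_eq_submatrix σ j, siteState_eq_submatrix]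
    have hω := tensorPower_posSemidef (ι := {i // i ≠ j}) hσ
    have := (Matrix.PosSemidef.kronecker h hω).submatrix (Equiv.funSplitAt j Q)
    rw [sub_kronecker, Matrix.smul_kronecker] at this
    exact this
  have hsum : c • tensorPower ι σ - siteMean ι A σ =
      ((Fintype.card ι : ℂ)⁻¹) • ∑ j : ι, (c • tensorPower ι σ - siteState A σ j) := by
    rw [Finset.sum_sub_distrib, Finset.sum_const, smul_sub, siteMean, Finset.card_univ,
      ← Nat.cast_smul_eq_nsmul ℂ, smul_smul, inv_mul_cancel₀ (by simp), one_smul]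
  rw [LoewnerLE, hsum]
  exact (Matrix.posSemidef_sum _ fun j _ => hj j).smul card_inv_nonneg

variable [DecidableEq Q]

lemma trace_siteState_mul_matLog2_tensorPower {A σ : Matrix Q Q ℂ} {c : ℝ} (hA : IsDensityMatrix A)
    (hσ : IsDensityMatrix σ) (h : LoewnerLE A (c • σ)) (j : ι) :
    (siteState A σ j * matLog2 (tensorPower ι σ)).trace = (A * matLog2 σ).trace +
      (tensorPower {i // i ≠ j} σ * matLog2 (tensorPower {i // i ≠ j} σ)).trace := by
  have hω := tensorPower_posSemidef (ι := {i // i ≠ j}) hσ.1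
  have hsupp : SupportLE (A ⊗ₖ tensorPower {i // i ≠ j} σ) (σ ⊗ₖ tensorPower {i // i ≠ j} σ) := by
    refine supportLE_of_loewnerLE_smul (c := c) (hA.1.kronecker hω) ?_
    have := Matrix.PosSemidef.kronecker h hω
    rwa [sub_kronecker, Matrix.smul_kronecker] at this
  rw [tensorPower_eq_submatrix σ j, siteState_eq_submatrix, matLog2,
    hermCFC_submatrix _ (hσ.1.kronecker hω).isHermitian, Matrix.submatrix_mul_equiv,
    Matrix.trace_submatrix_equiv_equiv, ← matLog2,
    trace_mul_matLog2_kronecker hσ.1.isHermitian hω.isHermitian hsupp, ptrace2_kronecker,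
    ptrace1_kronecker, trace_tensorPower, hσ.2, hA.2, one_pow, one_smul, one_smul]

/-- The cross entropy of a site state relative to the uniform mixture is at most its cross
entropy relative to the tensor power. -/
lemma trace_siteState_mul_matLog2_siteMean_ge {A σ : Matrix Q Q ℂ} {c : ℝ}
    (hA : IsDensityMatrix A) (hσ : IsDensityMatrix σ) (h : LoewnerLE A (c • σ)) (j : ι) :
    ((A * matLog2 σ).trace +
      (tensorPower {i // i ≠ j} σ * matLog2 (tensorPower {i // i ≠ j} σ)).trace).re ≤
      (siteState A σ j * matLog2 (siteMean ι A σ)).trace.re := by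
  have : Nonempty ι := ⟨j⟩
  have hmean := siteMean_posSemidef (ι := ι) hA.1 hσ.1
  have hpow := tensorPower_posSemidef (ι := ι) hσ.1
  rw [← trace_siteState_mul_matLog2_tensorPower hA hσ h,
    ← trace_siteMean_mul A σ (fun π => by
      rw [matLog2, ← hermCFC_submatrix _ hpow.isHermitian, tensorPower_relabel]) j,
    ← trace_siteMean_mul A σ (fun π => by
      rw [matLog2, ← hermCFC_submatrix _ hmean.isHermitian, siteMean_relabel]) j]
  refine trace_mul_matLog2_le hmean hpow ?_ (supportLE_siteMean_tensorPower hA.1 hσ.1 h)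
  rw [trace_siteMean A σ hσ.2, trace_tensorPower, hA.2, hσ.2, one_pow]

end TensorPower

section ConvexSplit

variable {P Q : Type*} [Fintype Q]

/-- Splitting off the `j`-th copy of `Q` and grouping it with `P`. -/
def splitEquiv (P Q : Type*) {n : ℕ} (j : Fin n) :
    P × (Fin n → Q) ≃ (P × Q) × ({i // i ≠ j} → Q) :=
  ((Equiv.refl P).prodCongr (Equiv.funSplitAt j Q)).trans (Equiv.prodAssoc P Q _).symm

lemma blockState_eq_submatrix [DecidableEq Q] (ρ : Matrix (P × Q) (P × Q) ℂ)
    (σ : Matrix Q Q ℂ) {n : ℕ}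
    (j : Fin n) :
    blockState ρ σ n j = (ρ ⊗ₖ tensorPower {i // i ≠ j} σ).submatrix
      (splitEquiv P Q j) (splitEquiv P Q j) := by
  ext x y
  have : ∏ i ∈ Finset.univ.erase j, σ (x.2 i) (y.2 i) =
      ∏ i : {i // i ≠ j}, σ (x.2 i) (y.2 i) := Finset.prod_subtype _ (by simp) _
  rw [blockState, this]
  rfl

lemma ptrace1_blockState [Fintype P] [DecidableEq Q] (ρ : Matrix (P × Q) (P × Q) ℂ)
    (σ : Matrix Q Q ℂ) {n : ℕ} (j : Fin n) :
    ptrace1 (blockState ρ σ n j) = siteState (ptrace1 ρ) σ j := by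
  ext x y
  simp only [ptrace1, blockState, siteState, Finset.sum_mul]

lemma ptrace2_blockState [DecidableEq Q] (ρ : Matrix (P × Q) (P × Q) ℂ) {σ : Matrix Q Q ℂ}
    (hσ : σ.trace = 1)
    {n : ℕ} (j : Fin n) : ptrace2 (blockState ρ σ n j) = ptrace2 ρ := by
  ext p p'
  have h : ∑ r, tensorPower {i // i ≠ j} σ r r = 1 := by
    have := trace_tensorPower (ι := {i // i ≠ j}) σ
    rwa [hσ, one_pow] at this
  rw [blockState_eq_submatrix]
  calc _ = ∑ z : Q × ({i // i ≠ j} → Q),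
        ρ (p, z.1) (p', z.1) * tensorPower {i // i ≠ j} σ z.2 z.2 :=
        Equiv.sum_comp (Equiv.funSplitAt j Q) fun z =>
          ρ (p, z.1) (p', z.1) * tensorPower {i // i ≠ j} σ z.2 z.2
    _ = _ := by
        simp only [Fintype.sum_prod_type, ← Finset.mul_sum, h, mul_one, ptrace2]

lemma ptrace1_convexSplit [Fintype P] [DecidableEq Q] (ρ : Matrix (P × Q) (P × Q) ℂ)
    (σ : Matrix Q Q ℂ) (n : ℕ) :
    ptrace1 (convexSplit ρ σ n) = siteMean (Fin n) (ptrace1 ρ) σ := by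
  simp only [siteMean, ← ptrace1_blockState]
  ext x y
  simp only [ptrace1, convexSplit, Matrix.smul_apply, Matrix.sum_apply, Fintype.card_fin,
    smul_eq_mul, ← Finset.mul_sum]
  rw [Finset.sum_comm]

lemma ptrace1_loewnerLE [Fintype P] {ρ : Matrix (P × Q) (P × Q) ℂ} {σ : Matrix Q Q ℂ} {c : ℝ}
    (hρ : ρ.trace = 1) (h : LoewnerLE ρ (c • (ptrace2 ρ ⊗ₖ σ))) :
    LoewnerLE (ptrace1 ρ) (c • σ) := by
  have h1 := ptrace1_posSemidef h
  have h2 : ptrace1 (c • (ptrace2 ρ ⊗ₖ σ) - ρ) = c • ptrace1 (ptrace2 ρ ⊗ₖ σ) - ptrace1 ρ := by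
    ext x y
    simp [ptrace1, Finset.sum_sub_distrib, Finset.mul_sum]
  rwa [h2, ptrace1_kronecker, trace_ptrace2, hρ, one_smul] at h1

variable [Fintype P] [DecidableEq P] [DecidableEq Q]

lemma supportLE_blockState {ρ : Matrix (P × Q) (P × Q) ℂ} {σ : Matrix Q Q ℂ}
    (hρ : ρ.PosSemidef) (hσ : IsDensityMatrix σ) {n : ℕ} (j : Fin n) :
    SupportLE (blockState ρ σ n j) (ptrace2 ρ ⊗ₖ siteMean (Fin n) (ptrace1 ρ) σ) := by
  have : Nonempty (Fin n) := ⟨j⟩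
  have hblock : (blockState ρ σ n j).PosSemidef := by
    rw [blockState_eq_submatrix]
    exact (hρ.kronecker (tensorPower_posSemidef hσ.1)).submatrix _
  have hA := ptrace2_posSemidef hρ
  have hB := ptrace1_posSemidef hρ
  refine (supportLE_ptrace_kronecker hblock).trans ?_
  rw [ptrace2_blockState ρ hσ.2, ptrace1_blockState]
  refine supportLE_of_loewnerLE_smul (c := n)
    (hA.kronecker (siteState_posSemidef hB hσ.1 j)) ?_
  have := hA.kronecker (card_smul_siteMean_sub_siteState_posSemidef hB hσ.1 j)
  rwa [kronecker_sub, ← Nat.cast_smul_eq_nsmul ℝ, Matrix.kronecker_smul, Fintype.card_fin] at this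

/-- Replacing `σ ⊗ ⋯ ⊗ σ` by the marginal of the convex-split state does not increase the
relative entropy of a block state. -/
lemma relent_blockState_le {ρ : Matrix (P × Q) (P × Q) ℂ} {σ : Matrix Q Q ℂ} {c : ℝ}
    (hρ : IsDensityMatrix ρ) (hσ : IsDensityMatrix σ)
    (h : LoewnerLE ρ (c • (ptrace2 ρ ⊗ₖ σ))) {n : ℕ} (j : Fin n) :
    relent (blockState ρ σ n j) (ptrace2 ρ ⊗ₖ ptrace1 (convexSplit ρ σ n)) ≤
      relent ρ (ptrace2 ρ ⊗ₖ σ) := by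
  have hA := ptrace2_posSemidef hρ.1
  have hB : IsDensityMatrix (ptrace1 ρ) :=
    ⟨ptrace1_posSemidef hρ.1, by rw [trace_ptrace1, hρ.2]⟩
  have hω := tensorPower_posSemidef (ι := {i // i ≠ j}) hσ.1
  have hωtr : (tensorPower {i // i ≠ j} σ).trace = 1 := by
    rw [trace_tensorPower, hσ.2, one_pow]
  have hsupp := supportLE_of_loewnerLE_smul hρ.1 h
  have hsuppBlock := supportLE_blockState hρ.1 hσ j
  rw [ptrace1_convexSplit, relent, relent, if_pos hsuppBlock, if_pos hsupp, EReal.coe_le_coe_iff,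
    relentR, relentR,
    trace_mul_matLog2_kronecker hA.isHermitian hσ.1.isHermitian hsupp,
    trace_mul_matLog2_kronecker hA.isHermitian (siteMean_posSemidef hB.1 hσ.1).isHermitian
      hsuppBlock, ptrace2_blockState ρ hσ.2, ptrace1_blockState]
  have hself : (blockState ρ σ n j * matLog2 (blockState ρ σ n j)).trace =
      (ρ * matLog2 ρ).trace +
        (tensorPower {i // i ≠ j} σ * matLog2 (tensorPower {i // i ≠ j} σ)).trace := by
    rw [blockState_eq_submatrix, matLog2, hermCFC_submatrix _ (hρ.1.kronecker hω).isHermitian,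
      Matrix.submatrix_mul_equiv, Matrix.trace_submatrix_equiv_equiv, ← matLog2,
      trace_mul_matLog2_kronecker hρ.1.isHermitian hω.isHermitian fun v hv => hv,
      ptrace2_kronecker, ptrace1_kronecker, hωtr, hρ.2, one_smul, one_smul]
  have hkey := trace_siteState_mul_matLog2_siteMean_ge hB hσ (ptrace1_loewnerLE hρ.2 h) j
  rw [hself]
  simp only [Complex.sub_re, Complex.add_re] at hkey ⊢
  linarith

end ConvexSplit

/-- If ρ_PQ ≤ 2^k·(ρ_P ⊗ σ_Q), then
D(ρ_{PQₙ} ⊗ σ_{Q₁} ⊗ … ⊗ σ_{Q_{n−1}} ‖ ρ_P ⊗ τ_{Q₁…Qₙ})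
  ≤ D(ρ_PQ ‖ ρ_P ⊗ σ_Q) + log(1/(1−δ)) + log(n)·exp(−δ²·2^{−k}·(n−1)/2). -/
theorem relent_block_upper_bound {P Q : Type} [Fintype P] [Fintype Q]
    [DecidableEq P] [DecidableEq Q] [Nonempty P] [Nonempty Q]
    (ρ : Matrix (P × Q) (P × Q) ℂ) (hρ : IsDensityMatrix ρ)
    (σ : Matrix Q Q ℂ) (hσ : IsDensityMatrix σ)
    (δ : ℝ) (hδ0 : 0 < δ) (hδ1 : δ < 1)
    (n : ℕ) (hn : 1 ≤ n)
    (k : ℝ) (hk0 : 0 ≤ k) (hk : LoewnerLE ρ (((2 : ℝ) ^ k) • (ptrace2 ρ ⊗ₖ σ))) :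
    relent (blockState ρ σ n ⟨n - 1, by omega⟩)
        (ptrace2 ρ ⊗ₖ ptrace1 (convexSplit ρ σ n)) ≤
      relent ρ (ptrace2 ρ ⊗ₖ σ)
        + ((Real.logb 2 (1 / (1 - δ))
            + Real.logb 2 (n : ℝ) *
              Real.exp (-(δ ^ 2) * (2 : ℝ) ^ (-k) * ((n : ℝ) - 1) / 2) : ℝ) : EReal) := by
  refine (relent_blockState_le hρ hσ hk _).trans ?_
  have hlog : 0 ≤ Real.logb 2 (1 / (1 - δ)) :=
    Real.logb_nonneg one_lt_two (by rw [le_div_iff₀ (by linarith)]; linarith)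
  have hlogn : 0 ≤ Real.logb 2 (n : ℝ) := Real.logb_nonneg one_lt_two (by exact_mod_cast hn)
  refine le_add_of_nonneg_right ?_
  rw [EReal.coe_nonneg]
  positivity

end
end

section
/- Let ρ, σ, τ be density matrices on a finite index type d and let k ∈ ℝ be such that ρ ≤ 2^{2k}·σ in the Loewner order. Then F(τ, ρ) ≤ 2^k·F(τ, σ). -/
open scoped Kronecker BigOperators
open Matrix
open scoped ComplexOrder Classical

noncomputable section

open scoped MatrixOrder Matrix.Norms.L2Operator

theorem matSqrt_eq_sqrt {d : Type*} [Fintype d] [DecidableEq d] {A : Matrix d d ℂ}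
    (hA : A.PosSemidef) : matSqrt A = CFC.sqrt A := by
  rw [CFC.sqrt_eq_real_sqrt A hA.nonneg, cfcₙ_eq_cfc, hA.isHermitian.cfc_eq, matSqrt, hermCFC,
    dif_pos hA.isHermitian, Matrix.IsHermitian.cfc, Unitary.conjStarAlgAut_apply]
  rfl

theorem posSemidef_matSqrt {d : Type*} [Fintype d] [DecidableEq d] {A : Matrix d d ℂ}
    (hA : A.PosSemidef) : (matSqrt A).PosSemidef := by
  rw [matSqrt_eq_sqrt hA]
  exact Matrix.nonneg_iff_posSemidef.mp (CFC.sqrt_nonneg A)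

theorem matSqrt_mul_self {d : Type*} [Fintype d] [DecidableEq d] {A : Matrix d d ℂ}
    (hA : A.PosSemidef) : matSqrt A * matSqrt A = A := by
  rw [matSqrt_eq_sqrt hA]
  exact CFC.sqrt_mul_sqrt_self A hA.nonneg

theorem trace_matSqrt {d : Type*} [Fintype d] [DecidableEq d] {A : Matrix d d ℂ}
    (hA : A.IsHermitian) :
    (matSqrt A).trace = (A.charpoly.roots.map fun z => (Real.sqrt z.re : ℂ)).sum := by
  rw [hA.roots_charpoly_eq_eigenvalues, matSqrt, hermCFC, dif_pos hA, Matrix.trace_mul_cycle,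
    Unitary.coe_star_mul_self, one_mul, Matrix.trace_diagonal]
  simp

theorem posSemidef_matSqrt_mul_mul_matSqrt {d : Type*} [Fintype d] [DecidableEq d]
    {A B : Matrix d d ℂ} (hA : A.PosSemidef) (hB : B.PosSemidef) :
    (matSqrt B * A * matSqrt B).PosSemidef := by
  simpa only [(posSemidef_matSqrt hB).isHermitian.eq] using
    hA.mul_mul_conjTranspose_same (matSqrt B)

theorem fidelity_comm {d : Type*} [Fintype d] [DecidableEq d] {A B : Matrix d d ℂ}
    (hA : A.PosSemidef) (hB : B.PosSemidef) : fidelity A B = fidelity B A := by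
  have hcharpoly : (matSqrt B * A * matSqrt B).charpoly =
      (matSqrt A * B * matSqrt A).charpoly := by
    conv_lhs => rw [← matSqrt_mul_self hA]
    conv_rhs => rw [← matSqrt_mul_self hB]
    have hAB := Matrix.charpoly_mul_comm (matSqrt B * matSqrt A) (matSqrt A * matSqrt B)
    simpa only [mul_assoc] using hAB
  rw [fidelity, fidelity, trace_matSqrt (posSemidef_matSqrt_mul_mul_matSqrt hA hB).isHermitian,
    trace_matSqrt (posSemidef_matSqrt_mul_mul_matSqrt hB hA).isHermitian, hcharpoly]

theorem re_trace_matSqrt_mono {d : Type*} [Fintype d] [DecidableEq d] {A B : Matrix d d ℂ}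
    (hA : A.PosSemidef) (hB : B.PosSemidef) (hAB : LoewnerLE A B) :
    (matSqrt A).trace.re ≤ (matSqrt B).trace.re := by
  rw [matSqrt_eq_sqrt hA, matSqrt_eq_sqrt hB]
  have hsqrt : (CFC.sqrt B - CFC.sqrt A).PosSemidef :=
    Matrix.le_iff.mp (CFC.sqrt_le_sqrt A B hAB)
  have htrace := (Complex.le_def.mp hsqrt.trace_nonneg).1
  rw [Matrix.trace_sub] at htrace
  simpa using htrace

theorem matSqrt_sq_smul {d : Type*} [Fintype d] [DecidableEq d] {A : Matrix d d ℂ}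
    (hA : A.PosSemidef) {c : ℝ} (hc : 0 ≤ c) : matSqrt (c ^ 2 • A) = c • matSqrt A := by
  rw [matSqrt_eq_sqrt (hA.smul (sq_nonneg c))]
  refine CFC.sqrt_unique ?_ ((posSemidef_matSqrt hA).smul hc).nonneg
  rw [smul_mul_smul_comm, matSqrt_mul_self hA, sq]

/-- If ρ ≤ 2^{2k}·σ in the Loewner order then F(τ,ρ) ≤ 2^k·F(τ,σ). -/
theorem fidelity_le_of_loewner {d : Type} [Fintype d] [DecidableEq d] [Nonempty d]
    (ρ σ τ : Matrix d d ℂ)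
    (hρ : IsDensityMatrix ρ) (hσ : IsDensityMatrix σ) (hτ : IsDensityMatrix τ)
    (k : ℝ) (h : LoewnerLE ρ (((2 : ℝ) ^ (2 * k)) • σ)) :
    fidelity τ ρ ≤ (2 : ℝ) ^ k * fidelity τ σ := by
  have hle : LoewnerLE (matSqrt τ * ρ * matSqrt τ)
      (((2 : ℝ) ^ k) ^ 2 • (matSqrt τ * σ * matSqrt τ)) := by
    have hconj := Matrix.PosSemidef.mul_mul_conjTranspose_same h (matSqrt τ)
    rwa [(posSemidef_matSqrt hτ.1).isHermitian.eq, mul_sub, sub_mul, mul_smul_comm,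
      smul_mul_assoc, mul_comm 2 k, Real.rpow_mul zero_le_two, Real.rpow_two] at hconj
  have hc : (0 : ℝ) ≤ 2 ^ k := by positivity
  have hρτ := posSemidef_matSqrt_mul_mul_matSqrt hρ.1 hτ.1
  have hστ := posSemidef_matSqrt_mul_mul_matSqrt hσ.1 hτ.1
  have hmono := re_trace_matSqrt_mono hρτ (hστ.smul (sq_nonneg _)) hle
  rw [matSqrt_sq_smul hστ hc, Matrix.trace_smul, Complex.smul_re, smul_eq_mul] at hmono
  rw [fidelity_comm hτ.1 hρ.1, fidelity_comm hτ.1 hσ.1]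
  exact hmono

end
end
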